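/- Across all rounds, every missing (user, part) pair is served exactly t times at the vertical positions: for all u, p ∈ [K] with V[p,u] = 0, the number of triples (k,i,j) with k ∈ [K], i ∈ {1,…,K−t}, j ∈ {1,…,t}, C_k[i,j] = u and R_k[i,j] = p equals t. -/

import Mathlib

/-- Placement matrix: `Vmat K t p k = 1` iff `(k - p) mod K ∈ {0, …, t-1}`. -/
def Vmat (K t : ℕ) (p k : ℕ) : ℕ :=
  if 0 ≤ ((k : ℤ) - (p : ℤ)) % (K : ℤ) ∧ ((k : ℤ) - (p : ℤ)) % (K : ℤ) < (t : ℤ)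
  then 1 else 0

/-- Delivery prime matrix `C_1`. -/
def C1 (K t : ℕ) (i j : ℕ) : ℕ :=
  if j ≤ t then j
  else if j + i - 1 ≤ K then j + i - 1 else j + i - 1 - (K - t)

/-- Delivery prime matrix `R_1`. -/
def R1 (K t : ℕ) (i j : ℕ) : ℕ :=
  if j ≤ t then (if i ≤ K - 2 * t + j then t + i else i + 2 * t - K)
  else 1

/-- Round-`k` matrix `C_k`, entrywise circular increment of `C_1`. -/
def Cmat (K t : ℕ) (k i j : ℕ) : ℕ := ((C1 K t i j + k - 2) % K) + 1

/-- Round-`k` matrix `R_k`, entrywise circular increment of `R_1`. -/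
def Rmat (K t : ℕ) (k i j : ℕ) : ℕ := ((R1 K t i j + k - 2) % K) + 1

theorem Nat.mod_eq_ite_of_lt_two_mul {a K : ℕ} (h : a < 2 * K) :
    a % K = if a < K then a else a - K := by
  split_ifs with h1
  · exact Nat.mod_eq_of_lt h1
  · rw [Nat.mod_eq_sub_mod (by omega), Nat.mod_eq_of_lt (by omega)]

/-- If part `p` is missing at user `u`, then `p - u` is congruent modulo `K` to some
`d ∈ {1, …, K - t}`. -/
theorem exists_offset_of_Vmat_eq_zero {K t u p : ℕ} (hu : u ∈ Finset.Icc 1 K)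
    (hp : p ∈ Finset.Icc 1 K) (hV : Vmat K t p u = 0) :
    ∃ d, 1 ≤ d ∧ d + t ≤ K ∧ (p = u + d ∨ p + K = u + d) := by
  rw [Finset.mem_Icc] at hu hp
  unfold Vmat at hV
  rw [ite_eq_right_iff] at hV
  by_cases h : p ≤ u
  · rw [Int.emod_eq_of_lt (by omega) (by omega)] at hV
    exact ⟨p + K - u, by omega, by omega, by omega⟩
  · rw [← Int.add_emod_right, Int.emod_eq_of_lt (by omega) (by omega)] at hV
    exact ⟨p - u, by omega, by omega, by omega⟩

/-- In a vertical column `j`, the matrix `R_1` takes each value of `{j + 1, …, j + K - t}`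
in exactly one row. -/
theorem R1_eq_add_iff {K t i j d : ℕ} (htK : 2 * t ≤ K) (hi : i ∈ Finset.Icc 1 (K - t))
    (hj : j ∈ Finset.Icc 1 t) (hd : 1 ≤ d) (hdK : d + t ≤ K) :
    R1 K t i j = j + d ↔ i = if t < j + d then j + d - t else j + d + K - 2 * t := by
  rw [Finset.mem_Icc] at hi hj
  unfold R1
  rw [if_pos hj.2]
  split_ifs <;> omega

theorem R1_mem_Icc {K t i j : ℕ} (htK : 2 * t ≤ K) (hi : i ∈ Finset.Icc 1 (K - t))
    (hj : j ∈ Finset.Icc 1 t) : R1 K t i j ∈ Finset.Icc (j + 1) (j + (K - t)) := by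
  rw [Finset.mem_Icc] at hi hj ⊢
  unfold R1
  rw [if_pos hj.2]
  split_ifs <;> omega

theorem Cmat_eq_iff {K t u k i j : ℕ} (htK : t ≤ K) (hu : u ∈ Finset.Icc 1 K)
    (hk : k ∈ Finset.Icc 1 K) (hj : j ∈ Finset.Icc 1 t) :
    Cmat K t k i j = u ↔ k = if j ≤ u then u + 1 - j else u + 1 + K - j := by
  rw [Finset.mem_Icc] at hu hk hj
  unfold Cmat C1
  rw [if_pos hj.2, Nat.mod_eq_ite_of_lt_two_mul (by omega)]
  split_ifs <;> omega

/-- At the vertical positions, the difference of `R_k` and `C_k` does not depend on `k`. -/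
theorem Rmat_eq_iff_of_Cmat_eq {K t u p d k i j : ℕ} (htK : 2 * t ≤ K)
    (hu : u ∈ Finset.Icc 1 K) (hp : p ∈ Finset.Icc 1 K) (hd : 1 ≤ d) (hdK : d + t ≤ K)
    (hpd : p = u + d ∨ p + K = u + d) (hk : k ∈ Finset.Icc 1 K)
    (hi : i ∈ Finset.Icc 1 (K - t)) (hj : j ∈ Finset.Icc 1 t)
    (hC : k = if j ≤ u then u + 1 - j else u + 1 + K - j) :
    Rmat K t k i j = p ↔ R1 K t i j = j + d := by
  have hR := R1_mem_Icc htK hi hj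
  rw [Finset.mem_Icc] at hu hp hk hj hR
  unfold Rmat
  generalize R1 K t i j = r at *
  rw [Nat.mod_eq_ite_of_lt_two_mul (by omega)]
  split_ifs at hC ⊢ <;> omega

/-- At the vertical positions, the round and the row are determined by the column and the
served (user, part) pair. -/
theorem Cmat_eq_and_Rmat_eq_iff {K t u p d k i j : ℕ} (htK : 2 * t ≤ K)
    (hu : u ∈ Finset.Icc 1 K) (hp : p ∈ Finset.Icc 1 K) (hd : 1 ≤ d) (hdK : d + t ≤ K)
    (hpd : p = u + d ∨ p + K = u + d) (hk : k ∈ Finset.Icc 1 K)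
    (hi : i ∈ Finset.Icc 1 (K - t)) (hj : j ∈ Finset.Icc 1 t) :
    (Cmat K t k i j = u ∧ Rmat K t k i j = p) ↔
      k = (if j ≤ u then u + 1 - j else u + 1 + K - j) ∧
      i = (if t < j + d then j + d - t else j + d + K - 2 * t) := by
  rw [Cmat_eq_iff (by omega) hu hk hj, ← R1_eq_add_iff htK hi hj hd hdK]
  exact and_congr_right (Rmat_eq_iff_of_Cmat_eq htK hu hp hd hdK hpd hk hi hj)

theorem stmt_13 (K t L : ℕ) (hK : 0 < K) (ht : 0 < t) (hL : 0 < L)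
    (htL : t ≤ L) (hKtL : t + L ≤ K) :
    ∀ u ∈ Finset.Icc 1 K, ∀ p ∈ Finset.Icc 1 K, Vmat K t p u = 0 →
      (((Finset.Icc 1 K) ×ˢ (Finset.Icc 1 (K - t)) ×ˢ (Finset.Icc 1 t)).filter
        (fun x => Cmat K t x.1 x.2.1 x.2.2 = u ∧ Rmat K t x.1 x.2.1 x.2.2 = p)).card
        = t := by
  intro u hu p hp hV
  have htK : 2 * t ≤ K := by omega
  obtain ⟨d, hd, hdK, hpd⟩ := exists_offset_of_Vmat_eq_zero hu hp hV
  have key : ∀ {k i j : ℕ}, k ∈ Finset.Icc 1 K → i ∈ Finset.Icc 1 (K - t) →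
      j ∈ Finset.Icc 1 t → _ :=
    fun hk hi hj => Cmat_eq_and_Rmat_eq_iff htK hu hp hd hdK hpd hk hi hj
  conv_rhs => rw [← Nat.add_sub_cancel (n := t) (m := 1), ← Nat.card_Icc]
  refine Finset.card_bij (fun x _ => x.2.2) ?_ ?_ ?_
  · rintro ⟨k, i, j⟩ hx
    simp only [Finset.mem_filter, Finset.mem_product] at hx
    exact hx.1.2.2
  · rintro ⟨k, i, j⟩ hx ⟨k', i', j'⟩ hy hj
    simp only [Finset.mem_filter, Finset.mem_product] at hx hy hj
    subst hj
    obtain ⟨⟨hk, hi, hj⟩, hx⟩ := hx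
    obtain ⟨⟨hk', hi', -⟩, hy⟩ := hy
    rw [key hk hi hj] at hx
    rw [key hk' hi' hj] at hy
    rw [hx.1, hx.2, hy.1, hy.2]
  · intro j hj
    have hk : (if j ≤ u then u + 1 - j else u + 1 + K - j) ∈ Finset.Icc 1 K := by
      rw [Finset.mem_Icc] at *
      split_ifs <;> omega
    have hi : (if t < j + d then j + d - t else j + d + K - 2 * t) ∈
        Finset.Icc 1 (K - t) := by
      rw [Finset.mem_Icc] at *
      split_ifs <;> omega
    refine ⟨(_, _, j), Finset.mem_filter.2 ⟨?_, (key hk hi hj).2 ⟨rfl, rfl⟩⟩, rfl⟩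
    exact Finset.mem_product.2 ⟨hk, Finset.mem_product.2 ⟨hi, hj⟩⟩
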